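/- Let ν = 1, so n = 2m with m odd, let a ∈ F_{2^m}^*, b ∈ F_4^*, and let ω ∈ F_{2^n}^* have polar decomposition ω = w_1·y with w_1 ∈ U_1 and y ∈ F_{2^m}^*. Then 3·(W_{f_{a,b}}(ω) − 1 − 2^m·(−1)^{f_{a,b}(w_1^{-1})}) = 1 − K_m(a) − 4·C_m(a,a) if b = 1, and 3·(W_{f_{a,b}}(ω) − 1 − 2^m·(−1)^{f_{a,b}(w_1^{-1})}) = 1 − K_m(a) + 2·C_m(a,a) if b ≠ 1. -/

import Mathlib

open Finset

attribute [local instance] Classical.propDecidable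

noncomputable section

/-- The absolute trace `Tr^k` of `GF(2^k)`, as a function on an ambient field of
characteristic two containing `GF(2^k)`. -/
def absTr {F : Type*} [Field F] (k : ℕ) (x : F) : F :=
  ∑ i ∈ Finset.range k, x ^ 2 ^ i

/-- The relative field trace `Tr^k_j` from `GF(2^k)` to `GF(2^j)`. -/
def relTr {F : Type*} [Field F] (k j : ℕ) (x : F) : F :=
  ∑ i ∈ Finset.range (k / j), x ^ 2 ^ (j * i)

/-- `(-1)^b` for `b ∈ F_2`, viewed inside an ambient field of characteristic two. -/
def sgn {F : Type*} [Field F] (b : F) : ℤ := if b = 0 then 1 else -1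

/-- The subfield `GF(2^k)` of the ambient field, as a finset. -/
def gf (F : Type*) [Field F] [Fintype F] (k : ℕ) : Finset F :=
  Finset.univ.filter fun x => x ^ 2 ^ k = x

/-- The trace of `F_4` down to `F_2`, `tr_2(y) = y + y²`. -/
def tr2 {F : Type*} [Field F] (y : F) : F := y + y ^ 2

/-- The cubic multiplicative character `χ_k(x) = x^((2^k-1)/3)` of `GF(2^k)`. -/
def chi {F : Type*} [Field F] (k : ℕ) (x : F) : F := x ^ ((2 ^ k - 1) / 3)

/-- The Walsh transform at `ω` of a Boolean function on `GF(2^n)`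
(with values in `F_2` inside the ambient field). -/
def walsh {F : Type*} [Field F] [Fintype F] (n : ℕ) (f : F → F) (ω : F) : ℤ :=
  ∑ x : F, sgn (f x + absTr n (ω * x))

/-- The binary Kloosterman sum `K_k(a)` (with the convention `0⁻¹ = 0`). -/
def kloo {F : Type*} [Field F] [Fintype F] (k : ℕ) (a : F) : ℤ :=
  ∑ x ∈ gf F k, sgn (absTr k (a * x + x⁻¹))

/-- The binary cubic sum `C_k(a,b)`. -/
def cub {F : Type*} [Field F] [Fintype F] (k : ℕ) (a b : F) : ℤ :=
  ∑ x ∈ gf F k, sgn (absTr k (a * x ^ 3 + b * x))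

/-- `f_a(x) = Tr^n(a · x^(2^{m₁}-1))`. -/
def fA {F : Type*} [Field F] (n m1 : ℕ) (a x : F) : F :=
  absTr n (a * x ^ (2 ^ m1 - 1))

/-- `g_b(x) = tr_2(b · χ_n(x))`. -/
def gB {F : Type*} [Field F] (n : ℕ) (b x : F) : F := tr2 (b * chi n x)

/-- The binomial Boolean function `f_{a,b} = f_a + g_b`. -/
def fAB {F : Type*} [Field F] (n m1 : ℕ) (a b x : F) : F :=
  fA n m1 a x + gB n b x

/-- `U`, the image of `U_1 × ⋯ × U_ν` in `GF(2^n)^*` under multiplication, where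
`U_i` is the subgroup of `(2^{m_i}+1)`-th roots of unity and `m_i = 2^{ν-i}·m`. -/
def bigU (F : Type*) [Field F] [Fintype F] (ν m : ℕ) : Finset F :=
  Finset.univ.filter fun u => ∃ c : Fin ν → F,
    (∀ i : Fin ν, c i ^ (2 ^ (2 ^ (ν - 1 - (i : ℕ)) * m) + 1) = 1) ∧ u = ∏ i, c i

open Polynomial in
lemma card_nthRootsFinset_one_of_dvd {F : Type*} [Field F] [Fintype F] {d : ℕ}
    (hd : d ∣ Fintype.card F - 1) : #(nthRootsFinset d (1 : F)) = d := by
  obtain ⟨g, hg⟩ := IsCyclic.exists_ofOrder_eq_natCard (α := Fˣ)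
  have hc : orderOf g = Fintype.card F - 1 := by
    rw [hg, Nat.card_eq_fintype_card, Fintype.card_units]
  have hp : IsPrimitiveRoot (g : F) (Fintype.card F - 1) :=
    IsPrimitiveRoot.coe_units_iff.2 (hc ▸ IsPrimitiveRoot.orderOf g)
  obtain ⟨e, he⟩ := hd
  have hpos : 0 < Fintype.card F - 1 := Nat.sub_pos_of_lt Fintype.one_lt_card
  exact (hp.pow hpos (he.trans (mul_comm d e))).card_nthRootsFinset

lemma sum_comp_of_card_fiber_le {α β : Type*} {s : Finset α} {t : Finset β} {f : α → β} {k : ℕ}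
    (hf : ∀ x ∈ s, f x ∈ t) (hk : ∀ y ∈ t, #{x ∈ s | f x = y} ≤ k) (hcard : #s = k * #t)
    (g : β → ℤ) : ∑ x ∈ s, g (f x) = k * ∑ y ∈ t, g y := by
  have hfib : ∀ y ∈ t, #{x ∈ s | f x = y} = k := by
    apply (sum_eq_sum_iff_of_le hk).1
    rw [← card_eq_sum_card_fiberwise hf, hcard, sum_const, smul_eq_mul, mul_comm]
  rw [← sum_fiberwise_of_maps_to hf, mul_sum]
  refine sum_congr rfl fun y hy => ?_
  rw [sum_congr rfl (g := fun _ => g y) fun x hx => by rw [(mem_filter.1 hx).2], sum_const,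
    hfib y hy, nsmul_eq_mul]

lemma sum_comp_of_injOn {α β : Type*} {s : Finset α} {t : Finset β} {f : α → β}
    (hf : ∀ x ∈ s, f x ∈ t) (hinj : ∀ x ∈ s, ∀ y ∈ s, f x = f y → x = y) (hcard : #s = #t)
    (g : β → ℤ) : ∑ x ∈ s, g (f x) = ∑ y ∈ t, g y := by
  have := sum_comp_of_card_fiber_le (k := 1) hf (fun y _ => card_le_one.2 fun a ha b hb => by
    rw [mem_filter] at ha hb
    exact hinj a ha.1 b hb.1 (ha.2.trans hb.2.symm)) (by rw [hcard, one_mul]) g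
  simpa using this

lemma sgn_add {F : Type*} [Field F] [CharP F 2] {x y : F} (hx : x = 0 ∨ x = 1)
    (hy : y = 0 ∨ y = 1) : sgn (x + y) = sgn x * sgn y := by
  rcases hx with rfl | rfl <;> rcases hy with rfl | rfl <;>
    simp [sgn, CharTwo.add_self_eq_zero]

section Trace

variable {F : Type*} [Field F] [CharP F 2]

lemma absTr_add (k : ℕ) (x y : F) : absTr k (x + y) = absTr k x + absTr k y := by
  simp only [absTr, ← sum_add_distrib]
  exact sum_congr rfl fun i _ => add_pow_char_pow x y 2 i

omit [CharP F 2] in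
lemma absTr_sq {k : ℕ} {x : F} (hx : x ^ 2 ^ k = x) : absTr k (x ^ 2) = absTr k x := by
  have h := (sum_range_succ (fun i => x ^ 2 ^ i) k).symm.trans
    (sum_range_succ' (fun i => x ^ 2 ^ i) k)
  rw [hx, pow_zero, pow_one] at h
  have h' := add_right_cancel h
  rw [absTr, absTr, h']
  refine sum_congr rfl fun i _ => ?_
  rw [← pow_mul, pow_succ']

lemma absTr_eq_zero_or_one {k : ℕ} {x : F} (hx : x ^ 2 ^ k = x) :
    absTr k x = 0 ∨ absTr k x = 1 := by
  have h : absTr k x ^ 2 = absTr k x := by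
    conv_rhs => rw [← absTr_sq hx]
    rw [absTr, sum_pow_char, absTr]
    exact sum_congr rfl fun i _ => pow_right_comm x _ _
  have h2 : absTr k x * (absTr k x - 1) = 0 := by linear_combination h
  rcases mul_eq_zero.1 h2 with h3 | h3
  · exact Or.inl h3
  · exact Or.inr (sub_eq_zero.1 h3)

lemma absTr_two_mul (m : ℕ) (x : F) : absTr (2 * m) x = absTr m (x + x ^ 2 ^ m) := by
  rw [absTr_add, two_mul, absTr, sum_range_add]
  simp only [absTr, ← pow_mul, pow_add]

lemma sgn_absTr_add {k : ℕ} {x y : F} (hx : x ^ 2 ^ k = x) (hy : y ^ 2 ^ k = y) :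
    sgn (absTr k (x + y)) = sgn (absTr k x) * sgn (absTr k y) := by
  rw [absTr_add, sgn_add (absTr_eq_zero_or_one hx) (absTr_eq_zero_or_one hy)]

lemma absTr_one_of_odd {k : ℕ} (hk : Odd k) : absTr k (1 : F) = 1 := by
  obtain ⟨j, rfl⟩ := hk
  have : (2 : F) = 0 := CharTwo.two_eq_zero
  simp [absTr, this]

lemma sum_gf_sgn_absTr_mul [Fintype F] {m : ℕ} (hm : Odd m) {a : F} (ha : a ^ 2 ^ m = a)
    (ha0 : a ≠ 0) : ∑ t ∈ gf F m, sgn (absTr m (a * t)) = 0 := by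
  have hinv : (a⁻¹) ^ 2 ^ m = a⁻¹ := by rw [inv_pow, ha]
  have hs : ∑ t ∈ gf F m, sgn (absTr m (a * t)) = ∑ t ∈ gf F m, -sgn (absTr m (a * t)) := by
    refine sum_nbij' (· + a⁻¹) (· + a⁻¹) ?_ ?_ ?_ ?_ ?_
    · intro t ht
      simp only [gf, mem_filter, mem_univ, true_and] at ht ⊢
      rw [add_pow_char_pow, ht, hinv]
    · intro t ht
      simp only [gf, mem_filter, mem_univ, true_and] at ht ⊢
      rw [add_pow_char_pow, ht, hinv]
    · intro t _
      simp [add_assoc, CharTwo.add_self_eq_zero]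
    · intro t _
      simp [add_assoc, CharTwo.add_self_eq_zero]
    · intro t ht
      simp only [gf, mem_filter, mem_univ, true_and] at ht
      rw [mul_add, mul_inv_cancel₀ ha0, sgn_absTr_add (by rw [mul_pow, ha, ht]) (one_pow _),
        absTr_one_of_odd hm]
      simp [sgn]
  rw [sum_neg_distrib] at hs
  omega

end Trace

lemma two_pow_two_mul_sub_one (m : ℕ) : 2 ^ (2 * m) - 1 = (2 ^ m + 1) * (2 ^ m - 1) := by
  rw [mul_comm 2 m, pow_mul, ← Nat.sq_sub_sq, one_pow]

lemma three_dvd_two_pow_add_one {m : ℕ} (hm : Odd m) : 3 ∣ 2 ^ m + 1 := by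
  simpa using Odd.nat_add_dvd_pow_add_pow 2 1 hm

section Roots

open Polynomial

variable {F : Type*} [Field F]

lemma mem_roots_sub_one {m : ℕ} (hm : m ≠ 0) {z : F} :
    z ∈ nthRootsFinset (2 ^ m - 1) (1 : F) ↔ z ≠ 0 ∧ z ^ 2 ^ m = z := by
  have h1 : 1 < 2 ^ m := Nat.one_lt_two_pow hm
  rw [mem_nthRootsFinset (by omega)]
  obtain ⟨k, hk⟩ : ∃ k, 2 ^ m = k + 2 := ⟨2 ^ m - 2, by omega⟩
  rw [hk, show k + 2 - 1 = k + 1 by omega, pow_succ z (k + 1)]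
  constructor
  · intro h
    refine ⟨?_, by rw [h, one_mul]⟩
    rintro rfl
    simp at h
  · rintro ⟨h0, h⟩
    exact mul_right_cancel₀ h0 (h.trans (one_mul z).symm)

lemma mem_roots_add_one {m : ℕ} {u : F} :
    u ∈ nthRootsFinset (2 ^ m + 1) (1 : F) ↔ u ≠ 0 ∧ u ^ 2 ^ m = u⁻¹ := by
  rw [mem_nthRootsFinset (Nat.succ_pos _), pow_succ]
  constructor
  · intro h
    have h0 : u ≠ 0 := by
      rintro rfl
      simp at h
    exact ⟨h0, eq_inv_of_mul_eq_one_left h⟩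
  · rintro ⟨h0, h⟩
    rw [h, inv_mul_cancel₀ h0]

variable [Fintype F]

lemma mem_gf {m : ℕ} {x : F} : x ∈ gf F m ↔ x ^ 2 ^ m = x := by simp [gf]

lemma gf_eq_insert {m : ℕ} (hm : m ≠ 0) :
    gf F m = insert 0 (nthRootsFinset (2 ^ m - 1) (1 : F)) := by
  ext x
  rw [mem_gf, mem_insert, mem_roots_sub_one hm]
  by_cases hx : x = 0 <;> simp [hx]

lemma sum_gf {m : ℕ} (hm : m ≠ 0) (g : F → ℤ) :
    ∑ x ∈ gf F m, g x = g 0 + ∑ x ∈ nthRootsFinset (2 ^ m - 1) (1 : F), g x := by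
  rw [gf_eq_insert hm, sum_insert]
  simp [mem_roots_sub_one hm]

variable {m : ℕ}

lemma card_roots_sub_one (hF : Fintype.card F = 2 ^ (2 * m)) :
    #(nthRootsFinset (2 ^ m - 1) (1 : F)) = 2 ^ m - 1 :=
  card_nthRootsFinset_one_of_dvd (by
    rw [hF, two_pow_two_mul_sub_one]
    exact dvd_mul_left _ _)

lemma card_roots_add_one (hF : Fintype.card F = 2 ^ (2 * m)) :
    #(nthRootsFinset (2 ^ m + 1) (1 : F)) = 2 ^ m + 1 :=
  card_nthRootsFinset_one_of_dvd (by
    rw [hF, two_pow_two_mul_sub_one]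
    exact dvd_mul_right _ _)

lemma card_gf (hF : Fintype.card F = 2 ^ (2 * m)) (hm : m ≠ 0) : #(gf F m) = 2 ^ m := by
  have h1 : 1 < 2 ^ m := Nat.one_lt_two_pow hm
  rw [gf_eq_insert hm, card_insert_of_notMem, card_roots_sub_one hF]
  · omega
  · simp [mem_roots_sub_one hm]

variable [CharP F 2]

lemma sum_add_inv (hF : Fintype.card F = 2 ^ (2 * m)) (hm : m ≠ 0)
    (g : F → ℤ) :
    ∑ u ∈ nthRootsFinset (2 ^ m + 1) (1 : F), g (u + u⁻¹) +
      ∑ z ∈ nthRootsFinset (2 ^ m - 1) (1 : F), g (z + z⁻¹) = 2 * ∑ t ∈ gf F m, g t := by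
  have h1 : 1 < 2 ^ m := Nat.one_lt_two_pow hm
  have hroots : ∀ x y : F, x ≠ 0 → y ≠ 0 → x + x⁻¹ = y + y⁻¹ → x = y ∨ x = y⁻¹ := by
    intro x y hx hy h
    have h2 : (x - y) * (x * y - 1) = 0 := by
      field_simp at h
      linear_combination h
    rcases mul_eq_zero.1 h2 with h3 | h3
    · exact Or.inl (sub_eq_zero.1 h3)
    · exact Or.inr (eq_inv_of_mul_eq_one_left (sub_eq_zero.1 h3))
  have hcommon : ∀ x y : F, x ∈ nthRootsFinset (2 ^ m + 1) (1 : F) →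
      y ∈ nthRootsFinset (2 ^ m - 1) (1 : F) → x + x⁻¹ = y + y⁻¹ → x = 1 ∧ y = 1 := by
    intro x y hx hy h
    rw [mem_roots_add_one] at hx
    rw [mem_roots_sub_one hm] at hy
    have hyq : x ^ 2 ^ m = x := by
      rcases hroots x y hx.1 hy.1 h with rfl | rfl
      · exact hy.2
      · rw [inv_pow, hy.2]
    have hx2 : x = x⁻¹ := hyq.symm.trans hx.2
    have hsq : (x - 1) ^ 2 = 0 := by
      have : x * x = 1 := by
        nth_rw 2 [hx2]
        exact mul_inv_cancel₀ hx.1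
      linear_combination this + (1 - x) * (CharTwo.two_eq_zero : (2 : F) = 0)
    have hx1 : x = 1 := sub_eq_zero.1 (pow_eq_zero_iff two_ne_zero |>.1 hsq)
    subst hx1
    rcases hroots 1 y hx.1 hy.1 h with h | h
    · exact ⟨rfl, h.symm⟩
    · exact ⟨rfl, by simpa using h.symm⟩
  set f : F ⊕ F → F := Sum.elim (fun u => u + u⁻¹) (fun z => z + z⁻¹) with hf
  have key := sum_comp_of_card_fiber_le
    (s := (nthRootsFinset (2 ^ m + 1) (1 : F)).disjSum (nthRootsFinset (2 ^ m - 1) (1 : F)))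
    (t := gf F m) (f := f) (k := 2) ?_ ?_ ?_ g
  · rw [sum_disjSum] at key
    exact_mod_cast key
  · rintro (x | x) hx
    · rw [inl_mem_disjSum, mem_roots_add_one] at hx
      rw [mem_gf]
      simp only [hf, Sum.elim_inl]
      rw [add_pow_char_pow, inv_pow, hx.2, inv_inv, add_comm]
    · rw [inr_mem_disjSum, mem_roots_sub_one hm] at hx
      rw [mem_gf]
      simp only [hf, Sum.elim_inr]
      rw [add_pow_char_pow, inv_pow, hx.2]
  · intro t _
    rcases (filter (fun x => f x = t) ((nthRootsFinset (2 ^ m + 1) (1 : F)).disjSum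
      (nthRootsFinset (2 ^ m - 1) (1 : F)))).eq_empty_or_nonempty with he | ⟨p, hp⟩
    · rw [he]
      simp
    rw [mem_filter] at hp
    obtain ⟨p', hp'⟩ : ∃ p', filter (fun x => f x = t) ((nthRootsFinset (2 ^ m + 1) (1 : F)).disjSum
      (nthRootsFinset (2 ^ m - 1) (1 : F))) ⊆ {p, p'} := by
      by_cases hp1 : p = Sum.inl 1 ∨ p = Sum.inr 1
      · refine ⟨p.swap, fun r hr => ?_⟩
        rw [mem_filter] at hr
        have hr1 : r = Sum.inl 1 ∨ r = Sum.inr 1 := by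
          have hfp : f p = 1 + 1⁻¹ := by rcases hp1 with rfl | rfl <;> simp [hf]
          have hfr := hr.2.trans (hp.2.symm.trans hfp)
          rcases r with x | x
          · rw [inl_mem_disjSum, mem_roots_add_one] at hr
            rcases hroots x 1 hr.1.1 one_ne_zero hfr with h | h <;> simp [h]
          · rw [inr_mem_disjSum, mem_roots_sub_one hm] at hr
            rcases hroots x 1 hr.1.1 one_ne_zero hfr with h | h <;> simp [h]
        rcases hp1 with rfl | rfl <;> rcases hr1 with rfl | rfl <;> simp
      · refine ⟨p.map (·⁻¹) (·⁻¹), fun r hr => ?_⟩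
        rw [mem_filter] at hr
        have hfr := hr.2.trans hp.2.symm
        rcases r with x | x <;> rcases p with y | y
        · rw [inl_mem_disjSum] at hr hp
          rcases hroots x y (mem_roots_add_one.1 hr.1).1 (mem_roots_add_one.1 hp.1).1 hfr
            with h | h <;> simp [h]
        · rw [inl_mem_disjSum] at hr
          rw [inr_mem_disjSum] at hp
          exact absurd (Or.inr (congrArg Sum.inr (hcommon x y hr.1 hp.1 hfr).2)) hp1
        · rw [inr_mem_disjSum] at hr
          rw [inl_mem_disjSum] at hp
          exact absurd (Or.inl (congrArg Sum.inl (hcommon y x hp.1 hr.1 hfr.symm).1)) hp1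
        · rw [inr_mem_disjSum] at hr hp
          rcases hroots x y ((mem_roots_sub_one hm).1 hr.1).1
            ((mem_roots_sub_one hm).1 hp.1).1 hfr with h | h <;> simp [h]
    exact (card_le_card hp').trans card_le_two
  · rw [card_disjSum, card_roots_add_one hF, card_roots_sub_one hF, card_gf hF hm]
    omega

omit [Fintype F] in
lemma sum_roots_add_one_sq (H : F → ℤ) :
    ∑ u ∈ nthRootsFinset (2 ^ m + 1) (1 : F), H (u ^ 2) =
      ∑ u ∈ nthRootsFinset (2 ^ m + 1) (1 : F), H u := by
  refine sum_comp_of_injOn (fun u hu => ?_) (fun u _ v _ h => CharTwo.sq_injective h) rfl H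
  rw [mem_nthRootsFinset (Nat.succ_pos _)] at hu ⊢
  rw [pow_right_comm, hu, one_pow]

omit [Fintype F] [CharP F 2] in
lemma sum_roots_sub_one_cube (hm : Odd m) (H : F → ℤ) :
    ∑ z ∈ nthRootsFinset (2 ^ m - 1) (1 : F), H (z ^ 3) =
      ∑ z ∈ nthRootsFinset (2 ^ m - 1) (1 : F), H z := by
  have h3 := three_dvd_two_pow_add_one hm
  have h1 : 1 < 2 ^ m := Nat.one_lt_two_pow hm.pos.ne'
  have hpos : 0 < 2 ^ m - 1 := by omega
  refine sum_comp_of_injOn (fun z hz => ?_) (fun z hz w hw h => ?_) rfl H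
  · rw [mem_nthRootsFinset hpos] at hz ⊢
    rw [pow_right_comm, hz, one_pow]
  · have hw0 := ((mem_roots_sub_one hm.pos.ne').1 hw).1
    rw [mem_nthRootsFinset hpos] at hz hw
    have hcop : Nat.gcd 3 (2 ^ m - 1) = 1 :=
      (Nat.Prime.coprime_iff_not_dvd Nat.prime_three).2 (by omega)
    have hq : (z / w) ^ Nat.gcd 3 (2 ^ m - 1) = 1 :=
      pow_gcd_eq_one.2 ⟨by rw [div_pow, h, div_self (pow_ne_zero _ hw0)],
        by rw [div_pow, hz, hw, div_one]⟩
    rw [hcop, pow_one] at hq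
    exact (div_eq_one_iff_eq hw0).1 hq

lemma sum_roots_sub_one_sgn_absTr (hm : m ≠ 0) {a : F} (ha : a ^ 2 ^ m = a) (ha0 : a ≠ 0) :
    ∑ z ∈ nthRootsFinset (2 ^ m - 1) (1 : F), sgn (absTr m (a * (z + z⁻¹))) = kloo m a - 1 := by
  have h0 : sgn (absTr m (a * 0 + 0⁻¹)) = 1 := by simp [absTr, sgn]
  rw [kloo, sum_gf hm, h0, add_sub_cancel_left]
  rw [← sum_comp_of_injOn (s := nthRootsFinset (2 ^ m - 1) (1 : F)) (f := fun y => a * y ^ 2)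
    (fun y hy => ?_) (fun u _ v _ h => CharTwo.sq_injective (mul_left_cancel₀ ha0 h)) rfl
    (fun z => sgn (absTr m (a * (z + z⁻¹))))]
  · refine sum_congr rfl fun y hy => ?_
    rw [mem_roots_sub_one hm] at hy
    have hy0 := hy.1
    have hfix : (a * y + y⁻¹) ^ 2 ^ m = a * y + y⁻¹ := by
      rw [add_pow_char_pow, mul_pow, inv_pow, ha, hy.2]
    rw [← absTr_sq hfix, CharTwo.add_sq]
    congr 2
    field_simp
  · rw [mem_roots_sub_one hm] at hy ⊢
    exact ⟨mul_ne_zero ha0 (pow_ne_zero _ hy.1), by rw [mul_pow, pow_right_comm, hy.2, ha]⟩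

lemma sum_roots_add_one_sgn_absTr (hF : Fintype.card F = 2 ^ (2 * m)) (hm : Odd m) {a : F}
    (ha : a ^ 2 ^ m = a) (ha0 : a ≠ 0) :
    ∑ u ∈ nthRootsFinset (2 ^ m + 1) (1 : F), sgn (absTr m (a * (u + u⁻¹))) = 1 - kloo m a := by
  have h := sum_add_inv hF hm.pos.ne' (fun t => sgn (absTr m (a * t)))
  rw [sum_gf_sgn_absTr_mul hm ha ha0, sum_roots_sub_one_sgn_absTr hm.pos.ne' ha ha0] at h
  omega

lemma sum_roots_add_one_sgn_absTr_cube (hF : Fintype.card F = 2 ^ (2 * m)) (hm : Odd m) {a : F}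
    (ha : a ^ 2 ^ m = a) (ha0 : a ≠ 0) :
    ∑ u ∈ nthRootsFinset (2 ^ m + 1) (1 : F), sgn (absTr m (a * (u ^ 3 + (u ^ 3)⁻¹))) =
      2 * cub m a a + 1 - kloo m a := by
  have hd : ∀ x : F, x ≠ 0 →
      a * (x + x⁻¹) ^ 3 + a * (x + x⁻¹) = a * (x ^ 3 + (x ^ 3)⁻¹) := by
    intro x hx
    have h2 : (2 : F) = 0 := CharTwo.two_eq_zero
    have : a * (x + x⁻¹) ^ 3 + a * (x + x⁻¹) =
        a * (x ^ 3 + (x ^ 3)⁻¹) + 2 * (2 * a * (x + x⁻¹)) := by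
      field_simp
      ring
    rw [this, h2, zero_mul, add_zero]
  have h := sum_add_inv hF hm.pos.ne' (fun t => sgn (absTr m (a * t ^ 3 + a * t)))
  rw [sum_congr rfl fun u hu => by rw [hd u (mem_roots_add_one.1 hu).1],
    sum_congr (s₁ := nthRootsFinset (2 ^ m - 1) (1 : F)) rfl
      fun u hu => by rw [hd u ((mem_roots_sub_one hm.pos.ne').1 hu).1],
    sum_roots_sub_one_cube hm (fun z => sgn (absTr m (a * (z + z⁻¹)))),
    sum_roots_sub_one_sgn_absTr hm.pos.ne' ha ha0] at h
  rw [cub]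
  omega

omit [CharP F 2] in
lemma sum_roots_add_one_comp_cube (hF : Fintype.card F = 2 ^ (2 * m)) (hm : Odd m) (H : F → ℤ) :
    ∑ v ∈ nthRootsFinset (2 ^ m + 1) (1 : F), H (v ^ 3) =
      3 * ∑ u ∈ nthRootsFinset (2 ^ m + 1) (1 : F) with u ^ ((2 ^ m + 1) / 3) = 1, H u := by
  obtain ⟨r, hr⟩ := three_dvd_two_pow_add_one hm
  have hdiv : (2 ^ m + 1) / 3 = r := by omega
  have hr0 : 0 < r := Nat.pos_of_ne_zero fun h => by simp [h] at hr
  have hcard := card_roots_add_one (F := F) hF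
  have hmem : ∀ x : F, x ∈ nthRootsFinset (2 ^ m + 1) (1 : F) ↔ x ^ (2 ^ m + 1) = 1 :=
    fun x => mem_nthRootsFinset (Nat.succ_pos _) 1
  have ht : {u ∈ nthRootsFinset (2 ^ m + 1) (1 : F) | u ^ r = 1} = nthRootsFinset r (1 : F) := by
    ext x
    rw [mem_filter, hmem, mem_nthRootsFinset hr0, and_iff_right_iff_imp, hr, mul_comm, pow_mul]
    intro h
    rw [h, one_pow]
  rw [hdiv]
  refine mod_cast sum_comp_of_card_fiber_le (k := 3) (fun v hv => ?_) (fun y _ => ?_) ?_ H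
  · rw [hmem] at hv
    rw [mem_filter, hmem, ← pow_mul v 3 r, ← hr, pow_right_comm, hv, one_pow]
    exact ⟨rfl, rfl⟩
  · have hsub : {v ∈ nthRootsFinset (2 ^ m + 1) (1 : F) | v ^ 3 = y} ⊆ nthRootsFinset 3 y := by
      intro v hv
      rw [mem_nthRootsFinset (by norm_num)]
      exact (mem_filter.1 hv).2
    refine (card_le_card hsub).trans ?_
    rw [nthRootsFinset]
    exact (Multiset.toFinset_card_le _).trans (card_nthRoots 3 y)
  · have hdvd : r ∣ Fintype.card F - 1 := by
      rw [hF, two_pow_two_mul_sub_one, hr]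
      exact (dvd_mul_left r 3).mul_right _
    rw [ht, hcard, card_nthRootsFinset_one_of_dvd hdvd, hr]

end Roots

/-- The `±1`-valued indicator of `1`. -/
def signOne {F : Type*} [Field F] (c : F) : ℤ := if c = 1 then 1 else -1

lemma one_add_add_sq_eq_zero {F : Type*} [Field F] {c : F} (hc : c ^ 3 = 1) (hc1 : c ≠ 1) :
    1 + c + c ^ 2 = 0 := by
  have h : (c - 1) * (1 + c + c ^ 2) = 0 := by linear_combination hc
  exact (mul_eq_zero.1 h).resolve_left (sub_ne_zero.2 hc1)

lemma tr2_eq {F : Type*} [Field F] [CharP F 2] {c : F} (hc : c ^ 3 = 1) :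
    tr2 c = if c = 1 then 0 else 1 := by
  have h2 : (2 : F) = 0 := CharTwo.two_eq_zero
  split_ifs with h
  · rw [h, tr2]
    linear_combination h2
  · rw [tr2]
    linear_combination one_add_add_sq_eq_zero hc h - h2

lemma sgn_tr2 {F : Type*} [Field F] [CharP F 2] {c : F} (hc : c ^ 3 = 1) :
    sgn (tr2 c) = signOne c := by
  rw [tr2_eq hc, signOne]
  split_ifs <;> simp [sgn]

lemma signOne_add_signOne_add_signOne {F : Type*} [Field F] {b c : F} (hb : b ^ 3 = 1)
    (hb1 : b ≠ 1) (hc : c ^ 3 = 1) :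
    signOne c + signOne (b * c) + signOne (b ^ 2 * c) = -1 := by
  have hb0 : b ≠ 0 := by
    rintro rfl
    simp at hb
  have hb2 : b ^ 2 ≠ 1 := fun h => hb1 (by rw [← hb, pow_succ, h, one_mul])
  by_cases hc1 : c = 1
  · simp [signOne, hc1, hb1, hb2]
  have hfac : (c - b) * (c - b ^ 2) = 0 := by
    linear_combination one_add_add_sq_eq_zero hc hc1 - c * one_add_add_sq_eq_zero hb hb1 + hb
  rcases mul_eq_zero.1 hfac with h | h
  · rw [sub_eq_zero.1 h, ← pow_two, ← pow_succ, hb]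
    simp [signOne, hb1, hb2]
  · rw [sub_eq_zero.1 h, ← pow_succ', hb, show b ^ 2 * b ^ 2 = b by linear_combination b * hb]
    simp [signOne, hb1, hb2]

section Walsh

open Polynomial

variable {F : Type*} [Field F] [Fintype F] [CharP F 2] {m : ℕ}

/-- The sum over the unit circle `U_1` of the signs of `f_{a,b}`. -/
def circleSum (m : ℕ) (a b : F) : ℤ :=
  ∑ u ∈ nthRootsFinset (2 ^ m + 1) (1 : F),
    sgn (absTr m (a * (u ^ 2 + (u ^ 2)⁻¹))) * signOne (b * u ^ ((2 ^ m + 1) / 3))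

omit [CharP F 2] [Fintype F] in
lemma pow_third_pow_three (hm : Odd m) {u : F} (hu : u ∈ nthRootsFinset (2 ^ m + 1) (1 : F)) :
    (u ^ ((2 ^ m + 1) / 3)) ^ 3 = 1 := by
  rw [← pow_mul, Nat.div_mul_cancel (three_dvd_two_pow_add_one hm)]
  exact (mem_nthRootsFinset (Nat.succ_pos _) 1).1 hu

lemma sum_roots_add_one_sgn_absTr_sq (hF : Fintype.card F = 2 ^ (2 * m)) (hm : Odd m) {a : F}
    (ha : a ^ 2 ^ m = a) (ha0 : a ≠ 0) :
    ∑ u ∈ nthRootsFinset (2 ^ m + 1) (1 : F), sgn (absTr m (a * (u ^ 2 + (u ^ 2)⁻¹))) =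
      1 - kloo m a := by
  rw [sum_roots_add_one_sq (fun u => sgn (absTr m (a * (u + u⁻¹)))),
    sum_roots_add_one_sgn_absTr hF hm ha ha0]

lemma three_mul_circleSum_one (hF : Fintype.card F = 2 ^ (2 * m)) (hm : Odd m) {a : F}
    (ha : a ^ 2 ^ m = a) (ha0 : a ≠ 0) :
    3 * circleSum m a 1 = 4 * cub m a a + kloo m a - 1 := by
  have hcube := sum_roots_add_one_comp_cube hF hm
    (fun u => sgn (absTr m (a * (u ^ 2 + (u ^ 2)⁻¹))))
  simp only [pow_right_comm _ 3 2] at hcube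
  rw [sum_roots_add_one_sq (fun u => sgn (absTr m (a * (u ^ 3 + (u ^ 3)⁻¹)))),
    sum_roots_add_one_sgn_absTr_cube hF hm ha ha0, sum_filter] at hcube
  have hall := sum_roots_add_one_sgn_absTr_sq hF hm ha ha0
  have hsplit : circleSum m a 1 =
      2 * (∑ u ∈ nthRootsFinset (2 ^ m + 1) (1 : F), if u ^ ((2 ^ m + 1) / 3) = 1 then
        sgn (absTr m (a * (u ^ 2 + (u ^ 2)⁻¹))) else 0) -
      ∑ u ∈ nthRootsFinset (2 ^ m + 1) (1 : F), sgn (absTr m (a * (u ^ 2 + (u ^ 2)⁻¹))) := by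
    rw [circleSum, mul_sum, ← sum_sub_distrib]
    refine sum_congr rfl fun u _ => ?_
    rw [one_mul, signOne]
    split_ifs <;> ring
  omega

omit [Fintype F] [CharP F 2] in
lemma circleSum_sq (hm : Odd m) {a b : F} (hb : b ^ 3 = 1) :
    circleSum m a (b ^ 2) = circleSum m a b := by
  have hb0 : b ≠ 0 := by
    rintro rfl
    simp at hb
  have hinv : ∀ u ∈ nthRootsFinset (2 ^ m + 1) (1 : F),
      u⁻¹ ∈ nthRootsFinset (2 ^ m + 1) (1 : F) := by
    intro u hu
    rw [mem_nthRootsFinset (Nat.succ_pos _)] at hu ⊢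
    rw [inv_pow, hu, inv_one]
  refine sum_nbij' (·⁻¹) (·⁻¹) hinv hinv (fun u _ => inv_inv u) (fun u _ => inv_inv u)
    fun u hu => ?_
  have hc := pow_third_pow_three hm hu
  simp only [inv_pow, inv_inv]
  rw [add_comm]
  congr 1
  set c := u ^ ((2 ^ m + 1) / 3)
  have hc0 : c ≠ 0 := by
    intro h
    simp [h] at hc
  have hiff : b ^ 2 * c = 1 ↔ b * c⁻¹ = 1 := by
    rw [mul_inv_eq_one₀ hc0]
    constructor
    · intro h
      linear_combination c * hb - b * h
    · rintro rfl
      rw [← pow_succ, hb]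
  simp only [signOne, hiff]

lemma three_mul_circleSum_of_ne_one (hF : Fintype.card F = 2 ^ (2 * m)) (hm : Odd m) {a b : F}
    (ha : a ^ 2 ^ m = a) (ha0 : a ≠ 0) (hb : b ^ 3 = 1) (hb1 : b ≠ 1) :
    3 * circleSum m a b = kloo m a - 1 - 2 * cub m a a := by
  have hone := three_mul_circleSum_one hF hm ha ha0
  have hsq := circleSum_sq hm (a := a) hb
  have hall := sum_roots_add_one_sgn_absTr_sq hF hm ha ha0
  have hsum : circleSum m a 1 + circleSum m a b + circleSum m a (b ^ 2) =
      -∑ u ∈ nthRootsFinset (2 ^ m + 1) (1 : F), sgn (absTr m (a * (u ^ 2 + (u ^ 2)⁻¹))) := by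
    simp only [circleSum, ← sum_add_distrib, ← sum_neg_distrib]
    refine sum_congr rfl fun u hu => ?_
    rw [one_mul, ← mul_add, ← mul_add,
      signOne_add_signOne_add_signOne hb hb1 (pow_third_pow_three hm hu), mul_neg_one]
  omega

omit [Fintype F] [CharP F 2] in
lemma mul_pow_two_pow_sub_one (hm : m ≠ 0) {u z : F}
    (hu : u ∈ nthRootsFinset (2 ^ m + 1) (1 : F)) (hz : z ∈ nthRootsFinset (2 ^ m - 1) (1 : F)) :
    (u * z) ^ (2 ^ m - 1) = (u ^ 2)⁻¹ := by
  have hu' := mem_roots_add_one.1 hu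
  rw [mem_nthRootsFinset (Nat.sub_pos_of_lt (Nat.one_lt_two_pow hm))] at hz
  rw [mul_pow, hz, mul_one, pow_sub₀ _ hu'.1 Nat.one_le_two_pow, hu'.2, pow_one, sq, mul_inv]

omit [Fintype F] [CharP F 2] in
lemma chi_mul_of_mem (hm : Odd m) {u z : F}
    (hu : u ∈ nthRootsFinset (2 ^ m + 1) (1 : F)) (hz : z ∈ nthRootsFinset (2 ^ m - 1) (1 : F)) :
    chi (2 * m) (u * z) = u ^ ((2 ^ m + 1) / 3) := by
  have h3 := three_dvd_two_pow_add_one hm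
  have h1 := Nat.one_lt_two_pow hm.pos.ne'
  have hc := pow_third_pow_three hm hu
  rw [mem_nthRootsFinset (Nat.sub_pos_of_lt h1)] at hz
  obtain ⟨k, hk⟩ : ∃ k, 2 ^ m - 1 = 3 * k + 1 := ⟨(2 ^ m - 2) / 3, by omega⟩
  rw [chi, two_pow_two_mul_sub_one, Nat.mul_div_right_comm h3, mul_pow, pow_mul u,
    mul_comm _ (2 ^ m - 1), pow_mul z, hz, one_pow, mul_one, hk, pow_succ, pow_mul, hc, one_pow,
    one_mul]

lemma sgn_fAB_add_absTr (hF : Fintype.card F = 2 ^ (2 * m)) (hm : Odd m) {a b u z : F}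
    (ha : a ^ 2 ^ m = a) (hb : b ^ 3 = 1) (hu : u ∈ nthRootsFinset (2 ^ m + 1) (1 : F))
    (hz : z ∈ nthRootsFinset (2 ^ m - 1) (1 : F)) (v : F) :
    sgn (fAB (2 * m) m a b (u * z) + absTr (2 * m) v) =
      sgn (absTr m (a * (u ^ 2 + (u ^ 2)⁻¹))) * signOne (b * u ^ ((2 ^ m + 1) / 3)) *
        sgn (absTr (2 * m) v) := by
  have hfix : ∀ x : F, x ^ 2 ^ (2 * m) = x := fun x => by rw [← hF, FiniteField.pow_card]
  have hu' := mem_roots_add_one.1 hu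
  have hc : (b * u ^ ((2 ^ m + 1) / 3)) ^ 3 = 1 := by
    rw [mul_pow, hb, pow_third_pow_three hm hu, one_mul]
  have htr : tr2 (b * u ^ ((2 ^ m + 1) / 3)) = 0 ∨ tr2 (b * u ^ ((2 ^ m + 1) / 3)) = 1 := by
    rw [tr2_eq hc]
    split_ifs <;> simp
  have hA : fA (2 * m) m a (u * z) = absTr m (a * (u ^ 2 + (u ^ 2)⁻¹)) := by
    rw [fA, absTr_two_mul, mul_pow_two_pow_sub_one hm.pos.ne' hu hz, mul_pow, inv_pow, ha,
      pow_right_comm, hu'.2, inv_pow, inv_inv, ← mul_add, add_comm]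
  have hv := absTr_eq_zero_or_one (hfix v)
  have hx : absTr m (a * (u ^ 2 + (u ^ 2)⁻¹)) = 0 ∨ absTr m (a * (u ^ 2 + (u ^ 2)⁻¹)) = 1 :=
    hA ▸ absTr_eq_zero_or_one (hfix _)
  rw [fAB, hA, gB, chi_mul_of_mem hm hu hz, ← sgn_tr2 hc, ← sgn_add hx htr]
  refine sgn_add ?_ hv
  rcases hx with hx | hx <;> rcases htr with ht | ht <;>
    simp [hx, ht, CharTwo.add_self_eq_zero]

lemma sum_polar (hF : Fintype.card F = 2 ^ (2 * m)) (hm : m ≠ 0) (H : F → ℤ) :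
    ∑ x, H x = H 0 + ∑ u ∈ nthRootsFinset (2 ^ m + 1) (1 : F),
      ∑ z ∈ nthRootsFinset (2 ^ m - 1) (1 : F), H (u * z) := by
  rw [← add_sum_erase univ H (mem_univ 0), ← sum_product']
  congr 1
  symm
  refine sum_comp_of_injOn (f := fun p : F × F => p.1 * p.2) (t := univ.erase 0) ?_ ?_ ?_ H
  · rintro ⟨u, z⟩ h
    rw [mem_product, mem_roots_add_one, mem_roots_sub_one hm] at h
    exact mem_erase.2 ⟨mul_ne_zero h.1.1 h.2.1, mem_univ _⟩
  · rintro ⟨u, z⟩ h ⟨u', z'⟩ h' he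
    rw [mem_product, mem_roots_add_one, mem_roots_sub_one hm] at h h'
    dsimp only at h h' he
    have hq : u⁻¹ * z = u'⁻¹ * z' := by
      have := congrArg (· ^ 2 ^ m) he
      simpa only [mul_pow, h.1.2, h.2.2, h'.1.2, h'.2.2] using this
    have hzz : z = z' := by
      apply CharTwo.sq_injective
      calc z ^ 2 = (u * z) * (u⁻¹ * z) := by field_simp [h.1.1]
        _ = z' ^ 2 := by
          rw [he, hq]
          field_simp [h'.1.1]
    subst hzz
    rw [mul_right_cancel₀ h.2.1 he]
  · rw [card_product, card_roots_add_one hF, card_roots_sub_one hF, card_erase_of_mem (mem_univ _),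
      card_univ, hF, two_pow_two_mul_sub_one]

lemma sum_roots_sub_one_sgn_absTr_mul (hF : Fintype.card F = 2 ^ (2 * m)) (hm : Odd m) {c : F}
    (hc : c ^ 2 ^ m = c) :
    ∑ z ∈ nthRootsFinset (2 ^ m - 1) (1 : F), sgn (absTr m (c * z)) =
      (if c = 0 then 2 ^ m else 0) - 1 := by
  have h0 : sgn (absTr m (c * 0)) = 1 := by simp [absTr, sgn]
  have h := sum_gf hm.pos.ne' (fun z => sgn (absTr m (c * z)))
  rw [h0] at h
  rw [← sub_eq_iff_eq_add'.2 h]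
  congr 1
  split_ifs with hc0
  · have h1 : ∀ z : F, sgn (absTr m (c * z)) = 1 := fun z => by simp [hc0, absTr, sgn]
    simp [h1, card_gf hF hm.pos.ne']
  · exact sum_gf_sgn_absTr_mul hm hc hc0

lemma walsh_eq (hF : Fintype.card F = 2 ^ (2 * m)) (hm : Odd m) {a b w y : F}
    (ha : a ^ 2 ^ m = a) (hb : b ^ 3 = 1) (hw : w ^ (2 ^ m + 1) = 1) (hy : y ^ 2 ^ m = y)
    (hy0 : y ≠ 0) :
    walsh (2 * m) (fAB (2 * m) m a b) (w * y) =
      1 + 2 ^ m * sgn (fAB (2 * m) m a b w⁻¹) - circleSum m a b := by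
  have hm0 := hm.pos.ne'
  have hwU : w ∈ nthRootsFinset (2 ^ m + 1) (1 : F) := (mem_nthRootsFinset (Nat.succ_pos _) 1).2 hw
  have hwU' : w⁻¹ ∈ nthRootsFinset (2 ^ m + 1) (1 : F) := by
    rw [mem_nthRootsFinset (Nat.succ_pos _), inv_pow, hw, inv_one]
  rw [mem_roots_add_one] at hwU
  have h1G : (1 : F) ∈ nthRootsFinset (2 ^ m - 1) (1 : F) := by simp [mem_roots_sub_one hm0]
  have hzero : sgn (fAB (2 * m) m a b 0 + absTr (2 * m) (w * y * 0)) = 1 := by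
    have h4 : 4 ≤ 2 ^ (2 * m) := by
      calc 4 = 2 ^ (2 * 1) := by norm_num
        _ ≤ 2 ^ (2 * m) := Nat.pow_le_pow_right (by norm_num) (by have := hm.pos; omega)
    have he1 : 2 ^ m - 1 ≠ 0 := (Nat.sub_pos_of_lt (Nat.one_lt_two_pow hm0)).ne'
    have he2 : (2 ^ (2 * m) - 1) / 3 ≠ 0 := by omega
    simp [fAB, fA, gB, chi, tr2, absTr, sgn, zero_pow he1, zero_pow he2]
  have hE := sgn_fAB_add_absTr hF hm ha hb hwU' h1G 0
  rw [show absTr (2 * m) (0 : F) = 0 by simp [absTr], mul_one, add_zero,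
    show sgn (0 : F) = 1 by simp [sgn], mul_one] at hE
  have hinner : ∀ u ∈ nthRootsFinset (2 ^ m + 1) (1 : F),
      ∑ z ∈ nthRootsFinset (2 ^ m - 1) (1 : F), sgn (absTr (2 * m) (w * y * (u * z))) =
        (if u = w⁻¹ then 2 ^ m else 0) - 1 := by
    intro u hu
    rw [mem_roots_add_one] at hu
    have hc : (y * (w * u + (w * u)⁻¹)) ^ 2 ^ m = y * (w * u + (w * u)⁻¹) := by
      rw [mul_pow, add_pow_char_pow, inv_pow, mul_pow, hy, hwU.2, hu.2, ← mul_inv, inv_inv,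
        add_comm]
    have hiff : y * (w * u + (w * u)⁻¹) = 0 ↔ u = w⁻¹ := by
      rw [mul_eq_zero, or_iff_right hy0, CharTwo.add_eq_zero]
      constructor
      · intro h
        refine eq_inv_of_mul_eq_one_right (CharTwo.sq_injective ?_)
        have h' := mul_inv_cancel₀ (mul_ne_zero hwU.1 hu.1)
        rw [← h] at h'
        simpa [sq] using h'
      · rintro rfl
        simp [hwU.1]
    have h := sum_roots_sub_one_sgn_absTr_mul hF hm hc
    simp only [hiff] at h
    rw [← h]
    refine sum_congr rfl fun z hz => ?_
    rw [mem_roots_sub_one hm0] at hz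
    rw [absTr_two_mul]
    congr 2
    simp only [mul_pow, hwU.2, hu.2, hy, hz.2, mul_inv]
    ring
  rw [walsh, sum_polar hF hm0, hzero, hE, circleSum]
  rw [sum_congr rfl fun u hu => by
    rw [sum_congr rfl fun z hz => sgn_fAB_add_absTr hF hm ha hb hu hz (w * y * (u * z)), ← mul_sum,
      hinner u hu, mul_sub, mul_one, mul_ite, mul_zero]]
  rw [sum_sub_distrib, sum_ite_eq', if_pos hwU']
  ring

end Walsh

/-- For `ν = 1` (so `n = 2m`, `m` odd), `a ∈ F_{2^m}^*`, `b ∈ F_4^*` and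
`ω ∈ F_{2^n}^*` with polar decomposition `ω = w₁·y` (`w₁ ∈ U_1`, `y ∈ F_{2^m}^*`):
`3·(W_{f_{a,b}}(ω) − 1 − 2^m·(−1)^{f_{a,b}(w₁⁻¹)}) = 1 − K_m(a) − 4·C_m(a,a)` if `b = 1`,
and `= 1 − K_m(a) + 2·C_m(a,a)` if `b ≠ 1`. -/
theorem walsh_at_nonzero_odd_case
    {F : Type*} [Field F] [Fintype F]
    (n m : ℕ) (hm : Odd m) (hn : n = 2 * m)
    (hF : Fintype.card F = 2 ^ n)
    (a b : F) (ha : a ^ 2 ^ m = a) (ha0 : a ≠ 0) (hb : b ^ 3 = 1)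
    (ω w1 y : F) (hω : ω ≠ 0)
    (hw1 : w1 ^ (2 ^ m + 1) = 1) (hy : y ^ 2 ^ m = y) (hy0 : y ≠ 0)
    (hdec : ω = w1 * y) :
    (b = 1 → 3 * (walsh n (fAB n m a b) ω - 1 - 2 ^ m * sgn (fAB n m a b w1⁻¹))
        = 1 - kloo m a - 4 * cub m a a) ∧
    (b ≠ 1 → 3 * (walsh n (fAB n m a b) ω - 1 - 2 ^ m * sgn (fAB n m a b w1⁻¹))
        = 1 - kloo m a + 2 * cub m a a) := by
  have : CharP F 2 := charP_of_card_eq_prime_pow hF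
  subst hn hdec
  rw [walsh_eq hF hm ha hb hw1 hy hy0]
  constructor
  · rintro rfl
    linear_combination -three_mul_circleSum_one hF hm ha ha0
  · intro hb1
    linear_combination -three_mul_circleSum_of_ne_one hF hm ha ha0 hb hb1
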